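/- An invertible real d×d matrix T has a real square root if and only if in the Jordan normal form of T every Jordan block corresponding to every negative (real) eigenvalue appears an even number of times. -/

import Mathlib

/-- The dimension of the kernel of the `k`-th power of `λ·I − T` (over `ℂ`), for a real
matrix `T` viewed as a complex matrix. -/
noncomputable def kerPowDim {d : ℕ} (T : Matrix (Fin d) (Fin d) ℝ) (lam : ℝ) (k : ℕ) : ℕ :=
  Module.finrank ℂ (LinearMap.ker (Matrix.toLin'
    (((lam : ℂ) • (1 : Matrix (Fin d) (Fin d) ℂ) - T.map Complex.ofReal) ^ k)))

open Polynomial Submodule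
open scoped Matrix

theorem exists_sq_sub_dvd_pow {R : Type*} [CommRing R] [Invertible (2 : R)] {p u q : R}
    (hq : p ∣ q ^ 2 - u) (hu : IsCoprime p u) (e : ℕ) : ∃ r, p ^ e ∣ r ^ 2 - u := by
  suffices h : ∀ e : ℕ, ∃ r, p ^ (e + 1) ∣ r ^ 2 - u from
    (h e).imp fun r hr => (pow_dvd_pow p e.le_succ).trans hr
  intro e
  induction e with
  | zero => exact ⟨q, by simpa using hq⟩
  | succ e ih =>
    obtain ⟨r, h, hr⟩ := ih
    have hpr : IsCoprime p r := by
      have : IsCoprime p (r ^ 2) := by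
        rw [show r ^ 2 = u + p * (p ^ e * h) by rw [← sub_eq_iff_eq_add', hr]; ring]
        exact hu.add_mul_left_right _
      exact (IsCoprime.pow_right_iff two_pos).1 this
    obtain ⟨a, b, hab⟩ := hpr
    have h2 : (2 : R) * ⅟ 2 = 1 := mul_invOf_self 2
    refine ⟨r - p ^ (e + 1) * (h * b * ⅟ 2), h * a + p ^ e * (h * b * ⅟ 2) ^ 2, ?_⟩
    have : (r - p ^ (e + 1) * (h * b * ⅟ 2)) ^ 2 - u
        = (r ^ 2 - u) - p ^ (e + 1) * (h * (b * r)) * (2 * ⅟ 2)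
          + p ^ (e + 1) * p ^ (e + 1) * (h * b * ⅟ 2) ^ 2 := by ring
    rw [this, hr, h2, show b * r = 1 - a * p by rw [← hab]; ring]
    ring

theorem Irreducible.dvd_of_aeval_eq_zero {K L : Type*} [Field K] [Field L] [Algebra K L]
    {p f : K[X]} (hp : Irreducible p) {z : L} (hz : aeval z p = 0) (hf : aeval z f = 0) :
    p ∣ f := by
  have hi : IsIntegral K z := isAlgebraic_iff_isIntegral.1 ⟨p, hp.ne_zero, hz⟩
  exact ((minpoly.irreducible hi).dvd_symm hp (minpoly.dvd K z hz)).trans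
    (minpoly.dvd K z hf)

/-- Modulo an irreducible real polynomial, `X` is a square unless the polynomial is associated
to `X - C r` with `r` negative. -/
theorem Irreducible.associated_or_exists_sq_sub_X {p : ℝ[X]} (hp : Irreducible p) :
    (∃ r : ℝ, r < 0 ∧ Associated p (X - C r)) ∨ ∃ q : ℝ[X], p ∣ q ^ 2 - X := by
  obtain ⟨z, hz⟩ := IsAlgClosed.exists_aeval_eq_zero ℂ p (degree_pos_of_irreducible hp).ne'
  by_cases him : z.im = 0
  · have hzr : z = (z.re : ℂ) := Complex.ext rfl (by simpa using him)
    rcases lt_or_ge z.re 0 with hneg | hpos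
    · refine Or.inl ⟨z.re, hneg, hp.associated_of_dvd (irreducible_X_sub_C _) ?_⟩
      refine hp.dvd_of_aeval_eq_zero hz ?_
      simp [← hzr]
    · refine Or.inr ⟨C √z.re, hp.dvd_of_aeval_eq_zero hz ?_⟩
      rw [map_sub, map_pow, aeval_C, aeval_X, ← map_pow, Real.sq_sqrt hpos]
      simp [← hzr]
  · right
    obtain ⟨w, hw⟩ := IsAlgClosed.exists_pow_nat_eq z two_pos
    refine ⟨C (w.re - w.im / z.im * z.re) + C (w.im / z.im) * X, hp.dvd_of_aeval_eq_zero hz ?_⟩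
    have : aeval z (C (w.re - w.im / z.im * z.re) + C (w.im / z.im) * X) = w := by
      apply Complex.ext <;> simp; field_simp
    rw [map_sub, map_pow, this, hw]
    simp

theorem Finset.exists_involution_of_even_card {α R : Type*} [Ring R] {s : Finset α}
    (hs : Even s.card) : ∃ (σ : α → α) (ε : α → R), ∀ a ∈ s,
      σ a ∈ s ∧ σ (σ a) = a ∧ ε a * ε (σ a) = -1 := by
  classical
  obtain ⟨t, u, rfl, hd, hc⟩ := Finset.exists_disjoint_union_of_even_card hs
  let e : t ≃ u := Finset.equivOfCardEq hc
  refine ⟨fun a => if h : a ∈ t then e ⟨a, h⟩ else if h : a ∈ u then e.symm ⟨a, h⟩ else a,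
    fun a => if a ∈ t then 1 else -1, fun a ha => ?_⟩
  have hu : ∀ x : u, (x : α) ∉ t := fun x hx => Finset.disjoint_left.1 hd hx x.2
  rcases Finset.mem_union.1 ha with h | h
  · simp [h, hu]
  · have := hu ⟨a, h⟩
    simp_all

/-- The kernel of a power of `r - S ^ 2` is even dimensional for negative `r`. -/
theorem even_finrank_ker_pow {E : Type*} [AddCommGroup E] [Module ℝ E] [FiniteDimensional ℝ E]
    (S : Module.End ℝ E) {r : ℝ} (hr : r < 0) (k : ℕ) :
    Even (Module.finrank ℝ (LinearMap.ker ((algebraMap ℝ (Module.End ℝ E) r - S ^ 2) ^ k))) := by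
  set V := LinearMap.ker ((algebraMap ℝ (Module.End ℝ E) r - S ^ 2) ^ k)
  have hcomm : Commute S ((algebraMap ℝ (Module.End ℝ E) r - S ^ 2) ^ k) :=
    ((Algebra.commute_algebraMap_right r S).sub_right (Commute.pow_right rfl 2)).pow_right k
  have hV : ∀ v ∈ V, S v ∈ V := fun v hv => by
    have := LinearMap.congr_fun hcomm.eq v
    simp only [Module.End.mul_apply] at this
    rw [LinearMap.mem_ker] at hv ⊢
    rw [← this, hv, map_zero]
  let g : Module.End ℝ V := S.restrict hV
  have hg : ∀ (m : ℕ) (v : V), (((algebraMap ℝ (Module.End ℝ V) r - g ^ 2) ^ m) v : E)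
      = ((algebraMap ℝ (Module.End ℝ E) r - S ^ 2) ^ m) v := by
    intro m
    induction m with
    | zero => simp
    | succ m ih =>
      intro v
      rw [pow_succ _ m, pow_succ _ m, Module.End.mul_apply, Module.End.mul_apply, ih]
      congr 1
  have hnil : IsNilpotent (algebraMap ℝ (Module.End ℝ V) r - g ^ 2) := ⟨k, by
    ext v
    rw [hg]
    exact v.2⟩
  have h1 := congrArg (eval r) hnil.charpoly_eq_X_pow_finrank
  rw [LinearMap.eval_charpoly, sub_sub_cancel, map_pow, eval_pow, eval_X] at h1
  by_contra h
  have := (Nat.not_even_iff_odd.1 h).pow_neg hr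
  nlinarith [sq_nonneg (LinearMap.det g)]

theorem finrank_ker_toLin'_map_ofReal {d : ℕ} (A : Matrix (Fin d) (Fin d) ℝ) :
    Module.finrank ℂ (LinearMap.ker (Matrix.toLin' (A.map Complex.ofReal)))
      = Module.finrank ℝ (LinearMap.ker (Matrix.toLin' A)) := by
  have hre : ∀ v : Fin d → ℂ, (fun i => (A.map Complex.ofReal *ᵥ v) i |>.re)
      = A *ᵥ fun i => (v i).re := fun v => by
    ext i; simp [Matrix.mulVec, dotProduct]
  have him : ∀ v : Fin d → ℂ, (fun i => (A.map Complex.ofReal *ᵥ v) i |>.im)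
      = A *ᵥ fun i => (v i).im := fun v => by
    ext i; simp [Matrix.mulVec, dotProduct]
  have hker : ∀ v : Fin d → ℂ, A.map Complex.ofReal *ᵥ v = 0 ↔
      (A *ᵥ fun i => (v i).re) = 0 ∧ (A *ᵥ fun i => (v i).im) = 0 := fun v => by
    rw [← hre, ← him]
    simp only [funext_iff, Complex.ext_iff, Pi.zero_apply, Complex.zero_re, Complex.zero_im,
      forall_and]
  let e : LinearMap.ker (Matrix.toLin' (A.map Complex.ofReal)) ≃ₗ[ℝ]
      LinearMap.ker (Matrix.toLin' A) × LinearMap.ker (Matrix.toLin' A) :=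
    { toFun := fun v => (⟨fun i => (v.1 i).re, ((hker v.1).1 v.2).1⟩,
        ⟨fun i => (v.1 i).im, ((hker v.1).1 v.2).2⟩)
      invFun := fun p => ⟨fun i => ⟨p.1.1 i, p.2.1 i⟩, (hker _).2 ⟨p.1.2, p.2.2⟩⟩
      map_add' := fun _ _ => rfl
      map_smul' := fun c v => by
        ext <;> simp
      left_inv := fun _ => rfl
      right_inv := fun _ => rfl }
  have h := e.finrank_eq
  rw [Module.finrank_prod, ← Module.finrank_mul_finrank ℝ ℂ, Complex.finrank_real_complex] at h
  omega

theorem finrank_torsionBy_congr {K M N : Type*} [Field K] [AddCommGroup M] [Module K M]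
    [Module K[X] M] [IsScalarTower K K[X] M] [AddCommGroup N] [Module K N]
    [Module K[X] N] [IsScalarTower K K[X] N] (φ : M ≃ₗ[K[X]] N) (f : K[X]) :
    Module.finrank K (torsionBy K[X] M f) = Module.finrank K (torsionBy K[X] N f) := by
  refine LinearEquiv.finrank_eq (LinearEquiv.restrictScalars K
    (φ.ofSubmodules (torsionBy K[X] M f) (torsionBy K[X] N f) ?_))
  ext x
  rw [mem_map_equiv, mem_torsionBy_iff, mem_torsionBy_iff, ← map_smul,
    LinearEquiv.map_eq_zero_iff]

theorem finrank_torsionBy_pi {K ι : Type*} [Field K] [Fintype ι] {M : ι → Type*}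
    [∀ i, AddCommGroup (M i)] [∀ i, Module K (M i)] [∀ i, Module K[X] (M i)]
    [∀ i, IsScalarTower K K[X] (M i)] [∀ i, FiniteDimensional K (M i)] (f : K[X]) :
    Module.finrank K (torsionBy K[X] (∀ i, M i) f)
      = ∑ i, Module.finrank K (torsionBy K[X] (M i) f) := by
  have (i : ι) : FiniteDimensional K (torsionBy K[X] (M i) f) :=
    inferInstanceAs (FiniteDimensional K ((torsionBy K[X] (M i) f).restrictScalars K))
  rw [← Module.finrank_pi_fintype K]
  exact LinearEquiv.finrank_eq
    { toFun := fun x i => ⟨x.1 i, congr_fun x.2 i⟩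
      invFun := fun x => ⟨fun i => x i, funext fun i => (x i).2⟩
      map_add' := fun _ _ => rfl
      map_smul' := fun _ _ => rfl
      left_inv := fun _ => rfl
      right_inv := fun _ => rfl }

theorem mk_mem_torsionBy_quotient_span_iff {R : Type*} [CommRing R] (f g x : R) :
    (Submodule.Quotient.mk x : R ⧸ R ∙ g) ∈ torsionBy R (R ⧸ R ∙ g) f ↔ g ∣ f * x := by
  rw [mem_torsionBy_iff, ← Submodule.Quotient.mk_smul, Submodule.Quotient.mk_eq_zero,
    Ideal.submodule_span_eq, Ideal.mem_span_singleton, smul_eq_mul]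

theorem finrank_torsionBy_quotient_span_mul {K : Type*} [Field K] {a b : K[X]}
    (ha : a ≠ 0) (hb : b ≠ 0) :
    Module.finrank K (torsionBy K[X] (K[X] ⧸ K[X] ∙ (a * b)) a) = a.natDegree := by
  let φ : K[X] →ₗ[K[X]] K[X] ⧸ K[X] ∙ (a * b) := (mkQ _).comp (LinearMap.mulLeft K[X] b)
  have hker : LinearMap.ker φ = K[X] ∙ a := by
    ext x
    simp only [φ, LinearMap.mem_ker, LinearMap.comp_apply, LinearMap.mulLeft_apply, mkQ_apply,
      Submodule.Quotient.mk_eq_zero, Ideal.submodule_span_eq, Ideal.mem_span_singleton]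
    rw [mul_comm a b, mul_dvd_mul_iff_left hb]
  have hrange : LinearMap.range φ = torsionBy K[X] (K[X] ⧸ K[X] ∙ (a * b)) a := by
    ext x
    obtain ⟨x, rfl⟩ := Submodule.Quotient.mk_surjective _ x
    refine Iff.trans ?_ (mk_mem_torsionBy_quotient_span_iff _ _ _).symm
    constructor
    · rintro ⟨y, hy⟩
      simp only [φ, LinearMap.comp_apply, LinearMap.mulLeft_apply, mkQ_apply] at hy
      rw [Submodule.Quotient.eq, Ideal.submodule_span_eq, Ideal.mem_span_singleton] at hy
      obtain ⟨z, hz⟩ := hy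
      exact ⟨y - a * z, by linear_combination -a * hz⟩
    · intro h
      obtain ⟨y, rfl⟩ := (mul_dvd_mul_iff_left ha).1 h
      exact ⟨y, rfl⟩
  rw [← hrange, ← (φ.quotKerEquivRange.restrictScalars K).finrank_eq, hker]
  exact finrank_quotient_span_eq_natDegree

theorem finrank_torsionBy_quotient_span_pow {K : Type*} [Field K] {p q : K[X]}
    (hp : Irreducible p) (hq : Irreducible q) [Decidable (Associated p q)] (e k : ℕ) :
    Module.finrank K (torsionBy K[X] (K[X] ⧸ K[X] ∙ (p ^ e)) (q ^ k))
      = if Associated p q then min k e * q.natDegree else 0 := by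
  split_ifs with h
  · have hspan : (K[X] ∙ (p ^ e)) = K[X] ∙ (q ^ e) :=
      Ideal.span_singleton_eq_span_singleton.2 (h.pow_pow)
    rw [hspan]
    rcases le_total k e with hk | hk
    · obtain ⟨m, rfl⟩ := Nat.exists_eq_add_of_le hk
      rw [pow_add, finrank_torsionBy_quotient_span_mul (pow_ne_zero _ hq.ne_zero) (pow_ne_zero _ hq.ne_zero),
        natDegree_pow, min_eq_left hk]
    · have : torsionBy K[X] (K[X] ⧸ K[X] ∙ (q ^ e)) (q ^ k) = ⊤ := by
        refine eq_top_iff.2 fun x _ => ?_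
        obtain ⟨x, rfl⟩ := Submodule.Quotient.mk_surjective _ x
        rw [mk_mem_torsionBy_quotient_span_iff]
        exact (pow_dvd_pow q hk).mul_right x
      rw [this, min_eq_right hk, ← natDegree_pow,
        ((topEquiv (R := K[X]) (M := K[X] ⧸ K[X] ∙ (q ^ e))).restrictScalars K).finrank_eq]
      exact finrank_quotient_span_eq_natDegree
  · have : torsionBy K[X] (K[X] ⧸ K[X] ∙ (p ^ e)) (q ^ k) = ⊥ := by
      refine eq_bot_iff.2 fun x hx => ?_
      obtain ⟨x, rfl⟩ := Submodule.Quotient.mk_surjective _ x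
      rw [mk_mem_torsionBy_quotient_span_iff] at hx
      rw [mem_bot, Submodule.Quotient.mk_eq_zero,
        Ideal.submodule_span_eq, Ideal.mem_span_singleton]
      have hc : IsCoprime p q := (hp.coprime_iff_not_dvd).2 fun hd =>
        h (hp.associated_of_dvd hq hd)
      exact (hc.pow).dvd_of_dvd_mul_left hx
    rw [this]
    exact Module.finrank_zero_of_subsingleton

theorem finrank_ker_pow_eq_finrank_torsionBy {K E : Type*} [Field K] [AddCommGroup E] [Module K E]
    (T : Module.End K E) (r : K) (k : ℕ) :
    Module.finrank K (LinearMap.ker ((algebraMap K (Module.End K E) r - T) ^ k))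
      = Module.finrank K (torsionBy K[X] (Module.AEval' T) ((C r - X) ^ k)) := by
  have h : aeval T ((C r - X) ^ k) = (algebraMap K (Module.End K E) r - T) ^ k := by simp
  rw [← h]
  exact LinearEquiv.finrank_eq
    { toFun := fun x => ⟨Module.AEval'.of T x.1, x.2⟩
      invFun := fun x => ⟨(Module.AEval'.of T).symm x.1, x.2⟩
      map_add' := fun _ _ => rfl
      map_smul' := fun _ _ => rfl
      left_inv := fun _ => rfl
      right_inv := fun _ => rfl }

theorem exists_comp_self_eq_smul_pi {R ι : Type*} [CommRing R] {I : ι → Ideal R} {σ : ι → ι}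
    {c : ι → R} {x : R} (hσ : ∀ i, σ (σ i) = i) (hI : ∀ i, I (σ i) = I i)
    (hc : ∀ i, c i * c (σ i) - x ∈ I i) :
    ∃ f : (∀ i, R ⧸ I i) →ₗ[R] (∀ i, R ⧸ I i), ∀ v, f (f v) = x • v := by
  refine ⟨LinearMap.pi fun i => c i • (quotEquivOfEq (I (σ i)) (I i) (hI i)).toLinearMap ∘ₗ
    LinearMap.proj (σ i), fun v => ?_⟩
  choose y hy using fun i => Submodule.Quotient.mk_surjective (I i) (v i)
  obtain rfl : (fun i => Submodule.Quotient.mk (y i)) = v := funext hy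
  ext i
  simp only [LinearMap.pi_apply, LinearMap.smul_apply, LinearMap.comp_apply, LinearMap.proj_apply,
    LinearEquiv.coe_coe, ← Submodule.Quotient.mk_smul, quotEquivOfEq_mk, hσ, Pi.smul_apply]
  rw [Submodule.Quotient.eq]
  have := (I i).mul_mem_right (y i) (hc i)
  rwa [sub_mul, mul_assoc] at this

theorem kerPowDim_eq_finrank_ker {d : ℕ} (T : Matrix (Fin d) (Fin d) ℝ) (lam : ℝ) (k : ℕ) :
    kerPowDim T lam k = Module.finrank ℝ
      (LinearMap.ker ((algebraMap ℝ (Module.End ℝ (Fin d → ℝ)) lam - Matrix.toLin' T) ^ k)) := by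
  have h : ((lam : ℂ) • (1 : Matrix (Fin d) (Fin d) ℂ) - T.map Complex.ofReal) ^ k
      = ((lam • (1 : Matrix (Fin d) (Fin d) ℝ) - T) ^ k).map Complex.ofReal := by
    have hmap : ∀ A : Matrix (Fin d) (Fin d) ℝ, A.map Complex.ofReal
      = Complex.ofRealHom.mapMatrix A := fun _ => rfl
    rw [hmap, hmap, map_pow, map_sub]
    congr 2
    ext i j
    by_cases hij : i = j <;> simp [hij]
  rw [kerPowDim, h, finrank_ker_toLin'_map_ofReal, Matrix.toLin'_pow, map_sub, map_smul,
    Matrix.toLin'_one, Algebra.algebraMap_eq_smul_one]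
  rfl

/-- The number of blocks of size `k` as a second difference. -/
theorem two_mul_sum_min_sub {ι : Type*} (s : Finset ι) (e : ι → ℕ) {k : ℕ} (hk : 1 ≤ k) :
    2 * ∑ i ∈ s, min k (e i) - ∑ i ∈ s, min (k - 1) (e i) - ∑ i ∈ s, min (k + 1) (e i)
      = (s.filter fun i => e i = k).card := by
  have : 2 * ∑ i ∈ s, min k (e i) = (∑ i ∈ s, min (k - 1) (e i)) + ∑ i ∈ s, min (k + 1) (e i)
      + (s.filter fun i => e i = k).card := by
    rw [Finset.card_filter, Finset.mul_sum, ← Finset.sum_add_distrib, ← Finset.sum_add_distrib]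
    refine Finset.sum_congr rfl fun i _ => ?_
    split_ifs <;> omega
  omega

/-- Multiplication by `X` has a square root on a sum of cyclic modules `ℝ[X] ⧸ (p i ^ e i)` when
each `p i` is prime to `X` and the summands for negative eigenvalues come in pairs. -/
theorem exists_comp_self_eq_X_smul {ι : Type*} [Fintype ι] {p : ι → ℝ[X]} {e : ι → ℕ}
    (hp : ∀ i, Irreducible (p i)) (hX : ∀ i, e i ≠ 0 → IsCoprime (p i) X)
    (heven : ∀ r : ℝ, r < 0 → ∀ k : ℕ, 1 ≤ k →
      Even {i | Associated (p i) (X - C r) ∧ e i = k}.ncard) :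
    ∃ f : (∀ i, ℝ[X] ⧸ ℝ[X] ∙ (p i ^ e i)) →ₗ[ℝ[X]] (∀ i, ℝ[X] ⧸ ℝ[X] ∙ (p i ^ e i)),
      ∀ v, f (f v) = (X : ℝ[X]) • v := by
  classical
  let key : ι → Associates ℝ[X] × ℕ := fun i => (Associates.mk (p i), e i)
  have hkey : ∀ i j, key i = key j ↔ Associated (p i) (p j) ∧ e i = e j := fun i j => by
    simp [key, Associates.mk_eq_mk_iff_associated]
  have hinv : Invertible (2 : ℝ[X]) := (Invertible.map C (2 : ℝ)).copy _ (C_ofNat 2).symm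
  have hj : ∀ j, ∃ (σ : ι → ι) (c : ι → ℝ[X]), ∀ i, key i = key j →
      key (σ i) = key j ∧ σ (σ i) = i ∧ p j ^ e j ∣ c i * c (σ i) - X := by
    intro j
    rcases eq_or_ne (e j) 0 with h0 | h0
    · exact ⟨id, 0, fun i hi => ⟨hi, rfl, by simp [h0]⟩⟩
    rcases (hp j).associated_or_exists_sq_sub_X with ⟨r, hr, hpr⟩ | ⟨q, hq⟩
    · have hs : {i | Associated (p i) (X - C r) ∧ e i = e j}
          = ↑(Finset.univ.filter fun i => key i = key j) := by
        ext i
        simp only [Set.mem_ofPred_eq, Finset.coe_filter, Finset.mem_univ, true_and, hkey]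
        exact and_congr_left fun _ => ⟨fun h => h.trans hpr.symm, fun h => h.trans hpr⟩
      have hcard := heven r hr (e j) (Nat.one_le_iff_ne_zero.2 h0)
      rw [hs, Set.ncard_coe_finset] at hcard
      obtain ⟨σ, ε, hσ⟩ := Finset.exists_involution_of_even_card (R := ℝ[X]) hcard
      have hq : p j ∣ (C √(-r)) ^ 2 - -X := by
        rw [← C_pow, Real.sq_sqrt (by linarith), C_neg]
        refine hpr.dvd.trans (dvd_of_eq ?_)
        ring
      obtain ⟨q, hq⟩ := exists_sq_sub_dvd_pow hq (hX j h0).neg_right (e j)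
      refine ⟨σ, fun i => ε i * q, fun i hi => ?_⟩
      obtain ⟨h1, h2, h3⟩ := hσ i (by simpa using hi)
      refine ⟨by simpa using h1, h2, ?_⟩
      rw [show ε i * q * (ε (σ i) * q) - X = -(q ^ 2 - -X) by linear_combination q ^ 2 * h3]
      exact hq.neg_right
    · obtain ⟨q, hq⟩ := exists_sq_sub_dvd_pow hq (hX j h0) (e j)
      exact ⟨id, fun _ => q, fun i hi => ⟨hi, rfl, by simpa [← sq] using hq⟩⟩
  have hκ : ∀ κ, ∃ (σ : ι → ι) (c : ι → ℝ[X]), ∀ i, key i = κ →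
      key (σ i) = κ ∧ σ (σ i) = i ∧ p i ^ e i ∣ c i * c (σ i) - X := by
    intro κ
    by_cases h : ∃ j, key j = κ
    · obtain ⟨j, rfl⟩ := h
      obtain ⟨σ, c, h⟩ := hj j
      refine ⟨σ, c, fun i hi => ⟨(h i hi).1, (h i hi).2.1, ?_⟩⟩
      obtain ⟨ha, he⟩ := (hkey i j).1 hi
      rw [he]
      exact ha.pow_pow.dvd.trans (h i hi).2.2
    · exact ⟨id, 0, fun i hi => absurd ⟨i, hi⟩ h⟩
  choose σ c h using hκ
  have hk : ∀ i, key (σ (key i) i) = key i := fun i => (h _ i rfl).1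
  refine exists_comp_self_eq_smul_pi (σ := fun i => σ (key i) i) (c := fun i => c (key i) i)
    (fun i => ?_) (fun i => ?_) fun i => ?_
  · rw [hk]
    exact (h _ i rfl).2.1
  · obtain ⟨ha, he⟩ := (hkey _ _).1 (hk i)
    rw [he]
    exact Ideal.span_singleton_eq_span_singleton.2 ha.pow_pow
  · rw [hk]
    exact Ideal.mem_span_singleton.2 (h _ i rfl).2.2

/-- An invertible real matrix `T` has a real square root iff in the Jordan normal form
of `T` every Jordan block to every negative eigenvalue appears an even number of times.
The number of Jordan blocks of size exactly `k` at `λ` equals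
`2·dim ker((λ−T)^k) − dim ker((λ−T)^{k−1}) − dim ker((λ−T)^{k+1})`. -/
theorem stmt_7 {d : ℕ} (T : Matrix (Fin d) (Fin d) ℝ) (hT : IsUnit T.det) :
    (∃ S : Matrix (Fin d) (Fin d) ℝ, S ^ 2 = T) ↔
      ∀ lam : ℝ, lam < 0 → ∀ k : ℕ, 1 ≤ k →
        Even (2 * kerPowDim T lam k - kerPowDim T lam (k - 1) - kerPowDim T lam (k + 1)) := by
  classical
  constructor
  · rintro ⟨S, rfl⟩ lam hlam k -
    have h : ∀ k, Even (kerPowDim (S ^ 2) lam k) := fun k => by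
      rw [kerPowDim_eq_finrank_ker, Matrix.toLin'_pow]
      exact even_finrank_ker_pow _ hlam k
    obtain ⟨a, ha⟩ := h k
    obtain ⟨b, hb⟩ := h (k - 1)
    obtain ⟨c, hc⟩ := h (k + 1)
    exact ⟨2 * a - b - c, by omega⟩
  · intro heven
    let t := Matrix.toLin' T
    obtain ⟨ι, _, p, hp, e, ⟨φ₀⟩⟩ := Module.equiv_directSum_of_isTorsion
      (Module.AEval.isTorsion_of_finiteDimensional ℝ (Fin d → ℝ) t)
    let φ := φ₀.trans (DirectSum.linearEquivFunOnFintype ℝ[X] ι _)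
    have hfin : ∀ i, FiniteDimensional ℝ (ℝ[X] ⧸ ℝ[X] ∙ (p i ^ e i)) := fun i =>
      Module.Finite.of_surjective ((LinearMap.proj i ∘ₗ φ.toLinearMap).restrictScalars ℝ)
        ((Function.surjective_eval i).comp φ.surjective)
    have hX : ∀ i, e i ≠ 0 → IsCoprime (p i) X := fun i hi => by
      obtain ⟨x, hx⟩ : ∃ x : Module.AEval' t, (X : ℝ[X]) • x
          = φ.symm fun i => Submodule.Quotient.mk 1 := by
        have hu : IsUnit T := (Matrix.isUnit_iff_isUnit_det T).2 hT
        obtain ⟨y, hy⟩ := (Matrix.mulVec_surjective_iff_isUnit.2 hu)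
          ((Module.AEval'.of t).symm (φ.symm fun i => Submodule.Quotient.mk 1))
        refine ⟨Module.AEval'.of t y, ?_⟩
        rw [Module.AEval.X_smul_of, ← LinearEquiv.eq_symm_apply, ← hy]
        rfl
      rw [LinearEquiv.eq_symm_apply, map_smul] at hx
      obtain ⟨y, hy⟩ := Submodule.Quotient.mk_surjective _ (φ x i)
      have h := congr_fun hx i
      rw [Pi.smul_apply, ← hy, ← Submodule.Quotient.mk_smul, Submodule.Quotient.eq,
        Ideal.submodule_span_eq, Ideal.mem_span_singleton] at h
      obtain ⟨z, hz⟩ := h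
      refine (IsCoprime.pow_left_iff (Nat.pos_of_ne_zero hi)).1 ⟨-z, y, ?_⟩
      rw [smul_eq_mul] at hz
      linear_combination hz
    have hcount : ∀ (r : ℝ) (k : ℕ), kerPowDim T r k
        = ∑ i ∈ Finset.univ.filter fun i => Associated (p i) (X - C r), min k (e i) := by
      intro r k
      have hq : Associated (X - C r) (C r - X) := ⟨-1, by simp⟩
      rw [kerPowDim_eq_finrank_ker, finrank_ker_pow_eq_finrank_torsionBy,
        finrank_torsionBy_congr φ, finrank_torsionBy_pi, Finset.sum_filter]
      refine Finset.sum_congr rfl fun i _ => ?_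
      have hdeg : (C r - X).natDegree = 1 := by rw [natDegree_sub, natDegree_X_sub_C]
      rw [finrank_torsionBy_quotient_span_pow (hp i) (hq.irreducible (irreducible_X_sub_C r)),
        hdeg, mul_one]
      exact if_congr ⟨fun h => h.trans hq.symm, fun h => h.trans hq⟩ rfl rfl
    obtain ⟨f, hf⟩ := exists_comp_self_eq_X_smul hp hX fun r hr k hk => by
      have := heven r hr k hk
      rw [hcount, hcount, hcount, two_mul_sum_min_sub _ _ hk, Finset.filter_filter,
        ← Set.ncard_coe_finset] at this
      simpa using this
    let g : Module.End ℝ (Fin d → ℝ) := (Module.AEval'.of t).symm.toLinearMap ∘ₗ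
      ((φ.symm.toLinearMap ∘ₗ f ∘ₗ φ.toLinearMap).restrictScalars ℝ) ∘ₗ
      (Module.AEval'.of t).toLinearMap
    refine ⟨LinearMap.toMatrix' g, ?_⟩
    rw [sq, ← LinearMap.toMatrix'_mul, ← LinearMap.toMatrix'_toLin' T]
    congr 1
    refine LinearMap.ext fun v => ?_
    change (Module.AEval'.of t).symm (φ.symm (f (φ (φ.symm (f (φ (Module.AEval'.of t v))))))) = t v
    rw [LinearEquiv.apply_symm_apply, hf, map_smul, LinearEquiv.symm_apply_apply,
      Module.AEval.X_smul_of, LinearEquiv.symm_apply_apply]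
    rfl
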